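/- arXiv:2411.17201 — 3 statements merged into one kernel-verified Lean document; each statement's English description precedes it below -/
import Mathlib

section
/- Let d, i, j, k be natural numbers with d ≥ 4, i ≥ k and j ≥ k. Then, with (z)_n denoting the rising factorial z(z+1)⋯(z+n−1) of a real number z (and (z)₀ = 1), the quantity c := [((d−2)/2)_k · ((d−2)/2)_{i−k} · ((d−2)/2)_{j−k} · (d−2)_{i+j−k}] / [(d−2)_i · (d−2)_j · (d/2)_{i+j−k}] satisfies c ≤ 1/(d−2)_k. -/
theorem geg_base (l : ℝ) (hl : 0 < l) (k b : ℕ) :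
    (ascPochhammer ℝ k).eval l * (ascPochhammer ℝ b).eval l
      ≤ (ascPochhammer ℝ (k + b)).eval (l + 1) := by
  induction b with
  | zero =>
    simp only [ascPochhammer_zero, Polynomial.eval_one, mul_one, add_zero]
    induction k with
    | zero => simp
    | succ k ih =>
      rw [ascPochhammer_succ_eval, ascPochhammer_succ_eval]
      have := ascPochhammer_pos k (l + 1) (by positivity)
      apply mul_le_mul ih (by linarith) (by positivity) this.le
  | succ b ih =>
    rw [← add_assoc, ascPochhammer_succ_eval, ascPochhammer_succ_eval, ← mul_assoc]
    have := ascPochhammer_pos (k + b) (l + 1) (by positivity)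
    have hk : (0 : ℝ) ≤ k := by positivity
    apply mul_le_mul ih (by push_cast; linarith) (by positivity) this.le

theorem geg_main (l : ℝ) (hl : 0 < l) (k a b : ℕ) :
    (ascPochhammer ℝ k).eval l * (ascPochhammer ℝ a).eval l * (ascPochhammer ℝ b).eval l *
      (ascPochhammer ℝ (k + b + a)).eval (2 * l) * (ascPochhammer ℝ k).eval (2 * l)
      ≤ (ascPochhammer ℝ (k + a)).eval (2 * l) * (ascPochhammer ℝ (k + b)).eval (2 * l) *
        (ascPochhammer ℝ (k + b + a)).eval (l + 1) := by
  induction a with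
  | zero =>
    have h1 := ascPochhammer_pos k (2 * l) (by positivity)
    have h2 := ascPochhammer_pos (k + b) (2 * l) (by positivity)
    have := mul_le_mul_of_nonneg_left (geg_base l hl k b) (mul_pos h1 h2).le
    simp only [ascPochhammer_zero, Polynomial.eval_one, mul_one, add_zero]
    linarith
  | succ a ih =>
    have h1 := ascPochhammer_pos (k + a) (2 * l) (by positivity)
    have h2 := ascPochhammer_pos (k + b) (2 * l) (by positivity)
    have h3 := ascPochhammer_pos (k + b + a) (l + 1) (by positivity)
    have hs : (l + a) * (2 * l + ((k + b + a : ℕ) : ℝ))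
        ≤ (2 * l + ((k + a : ℕ) : ℝ)) * (l + 1 + ((k + b + a : ℕ) : ℝ)) := by
      push_cast
      have : 0 ≤ (l + a) * (1 + k) + (l + k) * (1 + k + b) := by positivity
      linarith
    have := mul_le_mul ih hs (by positivity) (by positivity)
    rw [← add_assoc, ← add_assoc]
    simp only [ascPochhammer_succ_eval]
    linarith

/-- **Bound on the Gegenbauer linearization coefficient (Lemma `lemma::coeff bound linearization`).**
For `d ≥ 4` and `i, j ≥ k`, with `(z)_n` the rising factorial (Pochhammer symbol), the quantity
`c = [((d−2)/2)_k ((d−2)/2)_{i−k} ((d−2)/2)_{j−k} (d−2)_{i+j−k}] / [(d−2)_i (d−2)_j (d/2)_{i+j−k}]`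
satisfies `c ≤ 1/(d−2)_k`. -/
theorem gegenbauer_linearization_coeff_bound
    (d i j k : ℕ) (hd : 4 ≤ d) (hik : k ≤ i) (hjk : k ≤ j) :
    ((ascPochhammer ℝ k).eval (((d : ℝ) - 2) / 2) *
        (ascPochhammer ℝ (i - k)).eval (((d : ℝ) - 2) / 2) *
        (ascPochhammer ℝ (j - k)).eval (((d : ℝ) - 2) / 2) *
        (ascPochhammer ℝ (i + j - k)).eval ((d : ℝ) - 2)) /
      ((ascPochhammer ℝ i).eval ((d : ℝ) - 2) *
        (ascPochhammer ℝ j).eval ((d : ℝ) - 2) *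
        (ascPochhammer ℝ (i + j - k)).eval ((d : ℝ) / 2))
      ≤ 1 / (ascPochhammer ℝ k).eval ((d : ℝ) - 2) := by
  obtain ⟨a, rfl⟩ := Nat.exists_eq_add_of_le hik
  obtain ⟨b, rfl⟩ := Nat.exists_eq_add_of_le hjk
  have hd' : (4 : ℝ) ≤ d := by exact_mod_cast hd
  have hl : 0 < ((d : ℝ) - 2) / 2 := by linarith
  have h := geg_main _ hl k a b
  rw [show 2 * (((d : ℝ) - 2) / 2) = d - 2 by ring,
    show ((d : ℝ) - 2) / 2 + 1 = d / 2 by ring] at h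
  rw [show k + a + (k + b) - k = k + b + a by omega, show k + a - k = a by omega,
    show k + b - k = b by omega]
  have h0 : (0 : ℝ) < d - 2 := by linarith
  have h1 := ascPochhammer_pos (k + a) ((d : ℝ) - 2) h0
  have h2 := ascPochhammer_pos (k + b) ((d : ℝ) - 2) h0
  have h3 := ascPochhammer_pos (k + b + a) ((d : ℝ) / 2) (by linarith)
  have h4 := ascPochhammer_pos k ((d : ℝ) - 2) h0
  rw [div_le_div_iff₀ (by positivity) h4, one_mul]
  exact h
end

section
/- For every real number z with |z| ≤ 1, one has ∫_{−2}^{2} σ₁(z + b) db = 2z² + 14/3. -/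
noncomputable section

/-- The smoothed absolute-value activation: `σ₁(t) = t²` for `|t| < 1` and `σ₁(t) = 2|t| − 1`
for `|t| ≥ 1`. -/
def σ1 (t : ℝ) : ℝ := if |t| < 1 then t ^ 2 else 2 * |t| - 1

/-- For every `z` with `|z| ≤ 1`, `∫_{−2}^{2} σ₁(z + b) db = 2z² + 14/3`. -/
theorem random_feature_square (z : ℝ) (hz : |z| ≤ 1) :
    ∫ b in (-2 : ℝ)..2, σ1 (z + b) = 2 * z ^ 2 + 14 / 3 := by
  obtain ⟨h1, h2⟩ := abs_le.mp hz
  have e1 : Set.EqOn σ1 (fun t => -2 * t - 1) (Set.uIcc (z - 2) (-1)) := by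
    intro t ht
    rw [Set.uIcc_of_le (by linarith)] at ht
    have hn : |t| = -t := abs_of_nonpos (by linarith [ht.2])
    simp only [σ1, hn]
    rw [if_neg (by linarith [ht.2])]
    ring
  have e2 : Set.EqOn σ1 (fun t => t ^ 2) (Set.uIcc (-1) 1) := by
    intro t ht
    rw [Set.uIcc_of_le (by norm_num)] at ht
    simp only [σ1]
    split_ifs with h
    · rfl
    · have h3 : |t| = 1 := le_antisymm (abs_le.mpr ht) (not_lt.mp h)
      rw [← sq_abs, h3]
      norm_num
  have e3 : Set.EqOn σ1 (fun t => 2 * t - 1) (Set.uIcc 1 (z + 2)) := by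
    intro t ht
    rw [Set.uIcc_of_le (by linarith)] at ht
    have hn : |t| = t := abs_of_nonneg (by linarith [ht.1])
    simp only [σ1, hn]
    rw [if_neg (by linarith [ht.1])]
  have i1 : IntervalIntegrable σ1 MeasureTheory.volume (z - 2) (-1) := by
    apply ContinuousOn.intervalIntegrable
    exact ContinuousOn.congr (by fun_prop) e1
  have i2 : IntervalIntegrable σ1 MeasureTheory.volume (-1) 1 := by
    apply ContinuousOn.intervalIntegrable
    exact ContinuousOn.congr (by fun_prop) e2
  have i3 : IntervalIntegrable σ1 MeasureTheory.volume 1 (z + 2) := by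
    apply ContinuousOn.intervalIntegrable
    exact ContinuousOn.congr (by fun_prop) e3
  have c1 : ∫ t in (z - 2)..(-1), σ1 t = (z - 2) ^ 2 + (z - 2) := by
    rw [intervalIntegral.integral_congr e1, intervalIntegral.integral_sub
      (Continuous.intervalIntegrable (by fun_prop) _ _)
      (Continuous.intervalIntegrable (by fun_prop) _ _),
      intervalIntegral.integral_const_mul, integral_id, intervalIntegral.integral_const, smul_eq_mul]
    ring
  have c2 : ∫ t in (-1 : ℝ)..1, σ1 t = 2 / 3 := by
    rw [intervalIntegral.integral_congr e2, integral_pow]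
    norm_num
  have c3 : ∫ t in (1 : ℝ)..(z + 2), σ1 t = (z + 2) ^ 2 - (z + 2) := by
    rw [intervalIntegral.integral_congr e3, intervalIntegral.integral_sub
      (Continuous.intervalIntegrable (by fun_prop) _ _)
      (Continuous.intervalIntegrable (by fun_prop) _ _),
      intervalIntegral.integral_const_mul, integral_id, intervalIntegral.integral_const, smul_eq_mul]
    ring
  rw [intervalIntegral.integral_comp_add_left, ← sub_eq_add_neg,
    ← intervalIntegral.integral_add_adjacent_intervals (i1.trans i2) i3,
    ← intervalIntegral.integral_add_adjacent_intervals i1 i2, c1, c2, c3]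
  ring
end
end

section
/- For every integer k ≥ 3 and every real number z with |z| ≤ 1, one has ∫₀¹ (−1/2) · k(k−1)(k−2) · (1−b)^{k−3} · σ₁(z + b) db = z^k · 1_{z>0} − (k(k−1)/2) · z² − k·z − 1, where 1_{z>0} equals 1 if z > 0 and 0 otherwise. -/
noncomputable section

/-- Antiderivative computation for the purely quadratic integrand. -/
theorem quad_integral (n : ℕ) (w p q : ℝ) :
    ∫ b in p..q, (-1 / 2 : ℝ) * (((n : ℝ) + 3) * ((n : ℝ) + 2) * ((n : ℝ) + 1)) * (1 - b) ^ n *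
        (w + b) ^ 2 =
      (((n : ℝ) + 3) * ((n : ℝ) + 2) / 2 * (1 - q) ^ (n + 1) * (w + q) ^ 2 +
        ((n : ℝ) + 3) * (1 - q) ^ (n + 2) * (w + q) + (1 - q) ^ (n + 3)) -
      (((n : ℝ) + 3) * ((n : ℝ) + 2) / 2 * (1 - p) ^ (n + 1) * (w + p) ^ 2 +
        ((n : ℝ) + 3) * (1 - p) ^ (n + 2) * (w + p) + (1 - p) ^ (n + 3)) := by
  refine intervalIntegral.integral_eq_sub_of_hasDerivAt (f := fun x =>
      ((n : ℝ) + 3) * ((n : ℝ) + 2) / 2 * (1 - x) ^ (n + 1) * (w + x) ^ 2 +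
        ((n : ℝ) + 3) * (1 - x) ^ (n + 2) * (w + x) + (1 - x) ^ (n + 3)) ?_ ?_
  · intro x _
    have h1 : HasDerivAt (fun x : ℝ => 1 - x) (-1) x := by
      simpa using (hasDerivAt_id x).const_sub 1
    have h2 : HasDerivAt (fun x : ℝ => w + x) 1 x := by
      simpa using (hasDerivAt_id x).const_add w
    have h := ((((h1.pow (n + 1)).const_mul (((n : ℝ) + 3) * ((n : ℝ) + 2) / 2)).mul
      (h2.pow 2)).add (((h1.pow (n + 2)).const_mul ((n : ℝ) + 3)).mul h2)).add (h1.pow (n + 3))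
    refine h.congr_deriv ?_
    simp only [Pi.pow_apply, Nat.add_sub_cancel, show n + 2 - 1 = n + 1 from rfl,
      show n + 3 - 1 = n + 2 from rfl]
    push_cast
    ring
  · exact Continuous.intervalIntegrable (by fun_prop) _ _

theorem σ1_inner {t : ℝ} (h1 : -1 ≤ t) (h2 : t ≤ 1) : σ1 t = t ^ 2 := by
  unfold σ1
  split_ifs with h
  · rfl
  · have h3 : |t| = 1 := le_antisymm (abs_le.2 ⟨h1, h2⟩) (not_lt.1 h)
    rw [← sq_abs, h3]; norm_num

theorem σ1_outer {t : ℝ} (h1 : 1 ≤ t) : σ1 t = t ^ 2 - (t - 1) ^ 2 := by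
  unfold σ1
  rw [abs_of_nonneg (by linarith), if_neg (by linarith)]
  ring

/-- For every integer `k ≥ 3` and `|z| ≤ 1`,
`∫₀¹ (−1/2) k(k−1)(k−2) (1−b)^{k−3} σ₁(z + b) db
  = z^k 1_{z>0} − (k(k−1)/2) z² − kz − 1`. -/
theorem random_feature_monomial_half (k : ℕ) (hk : 3 ≤ k) (z : ℝ) (hz : |z| ≤ 1) :
    ∫ b in (0 : ℝ)..1,
        (-1 / 2 : ℝ) * ((k : ℝ) * ((k : ℝ) - 1) * ((k : ℝ) - 2)) * (1 - b) ^ (k - 3) *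
          σ1 (z + b) =
      z ^ k * (if 0 < z then 1 else 0) - ((k : ℝ) * ((k : ℝ) - 1) / 2) * z ^ 2 -
        (k : ℝ) * z - 1 := by
  obtain ⟨n, rfl⟩ : ∃ n, k = n + 3 := ⟨k - 3, by omega⟩
  obtain ⟨hz1, hz2⟩ := abs_le.1 hz
  have e1 : (((n + 3 : ℕ) : ℝ)) = (n : ℝ) + 3 := by push_cast; ring
  have e2 : (n : ℝ) + 3 - 1 = n + 2 := by ring
  have e3 : (n : ℝ) + 3 - 2 = n + 1 := by ring
  simp only [e1, e2, e3, Nat.add_sub_cancel]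
  by_cases hpos : 0 < z
  · have hA : ∀ b ∈ Set.uIcc (0 : ℝ) (1 - z),
        (-1 / 2 : ℝ) * (((n : ℝ) + 3) * ((n : ℝ) + 2) * ((n : ℝ) + 1)) * (1 - b) ^ n * (z + b) ^ 2 =
        (-1 / 2 : ℝ) * (((n : ℝ) + 3) * ((n : ℝ) + 2) * ((n : ℝ) + 1)) * (1 - b) ^ n *
          σ1 (z + b) := by
      intro b hb
      rw [Set.uIcc_of_le (by linarith)] at hb
      rw [σ1_inner (by linarith [hb.1]) (by linarith [hb.2])]
    have hB : ∀ b ∈ Set.uIcc (1 - z) 1,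
        (-1 / 2 : ℝ) * (((n : ℝ) + 3) * ((n : ℝ) + 2) * ((n : ℝ) + 1)) * (1 - b) ^ n * (z + b) ^ 2 -
        (-1 / 2 : ℝ) * (((n : ℝ) + 3) * ((n : ℝ) + 2) * ((n : ℝ) + 1)) * (1 - b) ^ n *
          ((z - 1) + b) ^ 2 =
        (-1 / 2 : ℝ) * (((n : ℝ) + 3) * ((n : ℝ) + 2) * ((n : ℝ) + 1)) * (1 - b) ^ n *
          σ1 (z + b) := by
      intro b hb
      rw [Set.uIcc_of_le (by linarith)] at hb
      rw [σ1_outer (by linarith [hb.1])]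
      ring
    rw [← intervalIntegral.integral_add_adjacent_intervals (b := 1 - z),
      ← intervalIntegral.integral_congr hA, ← intervalIntegral.integral_congr hB,
      intervalIntegral.integral_sub, quad_integral, quad_integral, quad_integral, if_pos hpos]
    · simp
      ring
    · exact Continuous.intervalIntegrable (by fun_prop) _ _
    · exact Continuous.intervalIntegrable (by fun_prop) _ _
    · refine IntervalIntegrable.congr (fun b hb => hA b (Set.uIoc_subset_uIcc hb)) ?_
      exact Continuous.intervalIntegrable (by fun_prop) _ _
    · refine IntervalIntegrable.congr (fun b hb => hB b (Set.uIoc_subset_uIcc hb)) ?_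
      exact Continuous.intervalIntegrable (by fun_prop) _ _
  · have hA : ∀ b ∈ Set.uIcc (0 : ℝ) 1,
        (-1 / 2 : ℝ) * (((n : ℝ) + 3) * ((n : ℝ) + 2) * ((n : ℝ) + 1)) * (1 - b) ^ n * (z + b) ^ 2 =
        (-1 / 2 : ℝ) * (((n : ℝ) + 3) * ((n : ℝ) + 2) * ((n : ℝ) + 1)) * (1 - b) ^ n *
          σ1 (z + b) := by
      intro b hb
      rw [Set.uIcc_of_le (by linarith)] at hb
      rw [σ1_inner (by linarith [hb.1]) (by linarith [hb.2])]
    rw [← intervalIntegral.integral_congr hA, quad_integral, if_neg hpos]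
    simp
    ring
end
end
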